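/- Let 1 ≤ M ≤ N be integers, E ∈ [0,1], n ≥ 1 an integer, and 0 = t_0 < t_1 < ⋯ < t_n = τ fixed real numbers with T_i = t_i − t_{i−1}. For λ > 0 define PFDavg(λ) = 1 − ∑_{x=M}^{N} S(M,N,x) · ∑_{i=1}^{n} e^{−x(1−E)λt_{i−1}} · (1 − e^{−xλT_i}) / (xλτ). Then, as λ → 0⁺, PFDavg(λ) / λ^{N−M+1} tends to C(N, M−1) / (N−M+2) · (1/τ) · ∑_{i=1}^{n} ((t_i − E·t_{i−1})^{N−M+2} − ((1−E)·t_{i−1})^{N−M+2}). -/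

import Mathlib

/-- The coefficient `S(M,N,x) = ∑_{k=M}^{x} C(N,x) · C(x,k) · (−1)^{x−k}`. -/
noncomputable def S (M N x : ℕ) : ℝ :=
  ∑ k ∈ Finset.Icc M x, (N.choose x : ℝ) * (x.choose k : ℝ) * (-1 : ℝ) ^ (x - k)

/-- Inclusion–exclusion: the polynomial with coefficients `S M N x` is the upper binomial tail. -/
lemma sum_S_mul_pow (M N : ℕ) (p : ℝ) :
    ∑ x ∈ Finset.Icc M N, S M N x * p ^ x =
      ∑ k ∈ Finset.Icc M N, (N.choose k : ℝ) * p ^ k * (1 - p) ^ (N - k) := by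
  simp only [S, Finset.sum_mul]
  rw [Finset.sum_comm' (t' := Finset.Icc M N) (s' := fun k => Finset.Icc k N)
    (by intro x k; simp only [Finset.mem_Icc]; omega)]
  refine Finset.sum_congr rfl fun k hk => ?_
  rw [Finset.mem_Icc] at hk
  have hpow : (1 - p) ^ (N - k) =
      ∑ j ∈ Finset.range (N - k + 1), (-p) ^ j * ((N - k).choose j : ℝ) := by
    rw [sub_eq_neg_add, add_pow]
    simp
  rw [hpow, Finset.mul_sum, Finset.range_eq_Ico]
  have hIcc : Finset.Icc k N = Finset.Ico (0 + k) (N - k + 1 + k) := by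
    ext x; simp only [Finset.mem_Icc, Finset.mem_Ico]; omega
  rw [hIcc, ← Finset.sum_Ico_add']
  refine Finset.sum_congr rfl fun j hj => ?_
  rw [Finset.mem_Ico] at hj
  have hc : ((N.choose (j + k) : ℝ)) * ((j + k).choose k : ℝ) =
      (N.choose k : ℝ) * ((N - k).choose j : ℝ) := by
    have := Nat.choose_mul (n := N) (k := j + k) (s := k) (by omega)
    rw [Nat.add_sub_cancel] at this
    exact_mod_cast this
  rw [hc, Nat.add_sub_cancel, neg_pow p j, pow_add]
  ring

/-- The complementary tail, with the leading power of `1 - p` factored out. -/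
lemma one_sub_sum_S_mul_pow (M N : ℕ) (hMN : M ≤ N) (p : ℝ) :
    1 - ∑ x ∈ Finset.Icc M N, S M N x * p ^ x =
      (1 - p) ^ (N - M + 1) *
        ∑ k ∈ Finset.range M, (N.choose k : ℝ) * p ^ k * (1 - p) ^ (M - 1 - k) := by
  have htotal : ∑ k ∈ Finset.range (N + 1), (N.choose k : ℝ) * p ^ k * (1 - p) ^ (N - k) = 1 := by
    have h := add_pow p (1 - p) N
    rw [add_sub_cancel, one_pow] at h
    refine Eq.trans (Finset.sum_congr rfl fun k _ => ?_) h.symm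
    ring
  have hIcc : Finset.Icc M N = Finset.Ico M (N + 1) := by
    ext x; simp only [Finset.mem_Icc, Finset.mem_Ico]; omega
  rw [← Finset.sum_range_add_sum_Ico _ (by omega : M ≤ N + 1)] at htotal
  rw [sum_S_mul_pow, hIcc, ← eq_sub_of_add_eq htotal, Finset.mul_sum]
  refine Finset.sum_congr rfl fun k hk => ?_
  rw [Finset.mem_range] at hk
  rw [show N - k = (N - M + 1) + (M - 1 - k) by omega, pow_add]
  ring

lemma integral_exp_neg_mul (c a b : ℝ) (hc : c ≠ 0) :
    ∫ v in a..b, Real.exp (-(c * v)) = (Real.exp (-(c * a)) - Real.exp (-(c * b))) / c := by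
  have hderiv : ∀ v ∈ Set.uIcc a b,
      HasDerivAt (fun v => -Real.exp (-(c * v)) / c) (Real.exp (-(c * v))) v := by
    intro v _
    have h := ((((hasDerivAt_id v).const_mul c).neg.exp).neg).div_const c
    refine h.congr_deriv ?_
    simp [hc]
  rw [intervalIntegral.integral_eq_sub_of_hasDerivAt hderiv
    (Continuous.intervalIntegrable (by fun_prop) _ _)]
  ring

lemma tendsto_one_sub_exp_div (v : ℝ) :
    Filter.Tendsto (fun lam : ℝ => (1 - Real.exp (-(lam * v))) / lam)
      (nhdsWithin 0 (Set.Ioi 0)) (nhds v) := by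
  have h : HasDerivAt (fun lam : ℝ => 1 - Real.exp (-(lam * v))) v 0 := by
    have h := ((((hasDerivAt_id (0 : ℝ)).mul_const v).neg.exp).const_sub 1)
    refine h.congr_deriv ?_
    simp
  have h' := h.tendsto_slope_zero_right
  refine h'.congr fun lam => ?_
  simp [div_eq_inv_mul]

lemma tendsto_unavailability_div_pow (M N : ℕ) (hM : 1 ≤ M) (hMN : M ≤ N) (v : ℝ) :
    Filter.Tendsto
      (fun lam : ℝ =>
        (1 - ∑ x ∈ Finset.Icc M N, S M N x * Real.exp (-(lam * v)) ^ x) / lam ^ (N - M + 1))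
      (nhdsWithin 0 (Set.Ioi 0)) (nhds ((N.choose (M - 1) : ℝ) * v ^ (N - M + 1))) := by
  have hR : Filter.Tendsto (fun lam : ℝ => ∑ k ∈ Finset.range M,
      (N.choose k : ℝ) * Real.exp (-(lam * v)) ^ k * (1 - Real.exp (-(lam * v))) ^ (M - 1 - k))
      (nhdsWithin 0 (Set.Ioi 0)) (nhds (N.choose (M - 1) : ℝ)) := by
    have hcont : Continuous (fun lam : ℝ => ∑ k ∈ Finset.range M,
        (N.choose k : ℝ) * Real.exp (-(lam * v)) ^ k *
          (1 - Real.exp (-(lam * v))) ^ (M - 1 - k)) := by fun_prop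
    refine (hcont.tendsto' 0 _ ?_).mono_left nhdsWithin_le_nhds
    rw [Finset.sum_eq_single_of_mem (M - 1) (Finset.mem_range.2 (by omega))]
    · simp
    · intro k hk hne
      rw [Finset.mem_range] at hk
      simp [show M - 1 - k ≠ 0 by omega]
  rw [mul_comm]
  refine (((tendsto_one_sub_exp_div v).pow (N - M + 1)).mul hR).congr fun lam => ?_
  rw [one_sub_sum_S_mul_pow M N hMN, div_pow]
  ring

lemma norm_unavailability_div_pow_le (M N : ℕ) (hMN : M ≤ N) {lam v : ℝ}
    (hlam : 0 < lam) (hv : 0 ≤ v) :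
    ‖(1 - ∑ x ∈ Finset.Icc M N, S M N x * Real.exp (-(lam * v)) ^ x) / lam ^ (N - M + 1)‖ ≤
      v ^ (N - M + 1) * ∑ k ∈ Finset.range M, (N.choose k : ℝ) := by
  have hp1 : Real.exp (-(lam * v)) ≤ 1 := Real.exp_le_one_iff.2 (by nlinarith)
  have hp0 := (Real.exp_pos (-(lam * v))).le
  have hp2 : 1 - Real.exp (-(lam * v)) ≤ lam * v := by
    linarith [Real.add_one_le_exp (-(lam * v))]
  rw [one_sub_sum_S_mul_pow M N hMN]
  generalize Real.exp (-(lam * v)) = p at *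
  have hq : 0 ≤ 1 - p := by linarith
  rw [Real.norm_of_nonneg (by positivity), div_le_iff₀ (by positivity), mul_right_comm,
    ← mul_pow, mul_comm v lam]
  gcongr with k hk
  calc (N.choose k : ℝ) * p ^ k * (1 - p) ^ (M - 1 - k)
      ≤ (N.choose k : ℝ) * 1 * 1 := by
        gcongr
        · exact pow_le_one₀ hp0 hp1
        · exact pow_le_one₀ hq (by linarith)
    _ = N.choose k := by ring

lemma tendsto_integral_unavailability_div_pow (M N : ℕ) (hM : 1 ≤ M) (hMN : M ≤ N) {a b : ℝ}
    (ha : 0 ≤ a) (hab : a ≤ b) :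
    Filter.Tendsto
      (fun lam : ℝ => ∫ v in a..b,
        (1 - ∑ x ∈ Finset.Icc M N, S M N x * Real.exp (-(lam * v)) ^ x) / lam ^ (N - M + 1))
      (nhdsWithin 0 (Set.Ioi 0))
      (nhds ((N.choose (M - 1) : ℝ) / ((N : ℝ) - M + 2) *
        (b ^ (N - M + 2) - a ^ (N - M + 2)))) := by
  have hint : ∫ v in a..b, (N.choose (M - 1) : ℝ) * v ^ (N - M + 1) =
      (N.choose (M - 1) : ℝ) / ((N : ℝ) - M + 2) * (b ^ (N - M + 2) - a ^ (N - M + 2)) := by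
    rw [intervalIntegral.integral_const_mul, integral_pow]
    push_cast [hMN]
    ring
  rw [← hint]
  refine intervalIntegral.tendsto_integral_filter_of_dominated_convergence
    (fun v => v ^ (N - M + 1) * ∑ k ∈ Finset.range M, (N.choose k : ℝ)) ?_ ?_ ?_ ?_
  · exact Filter.Eventually.of_forall fun lam =>
      Continuous.aestronglyMeasurable (by fun_prop)
  · filter_upwards [self_mem_nhdsWithin] with lam hlam
    refine Filter.Eventually.of_forall fun v hv => ?_
    rw [Set.uIoc_of_le hab] at hv
    exact norm_unavailability_div_pow_le M N hMN hlam (ha.trans hv.1.le)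
  · exact Continuous.intervalIntegrable (by fun_prop) _ _
  · exact Filter.Eventually.of_forall fun v _ =>
      tendsto_unavailability_div_pow M N hM hMN v

lemma integral_unavailability (M N : ℕ) (hM : 1 ≤ M) {lam : ℝ} (hlam : lam ≠ 0) (a b : ℝ) :
    ∫ v in a..b, (1 - ∑ x ∈ Finset.Icc M N, S M N x * Real.exp (-(lam * v)) ^ x) =
      (b - a) - ∑ x ∈ Finset.Icc M N, S M N x *
        (Real.exp (-(x * lam * a)) * (1 - Real.exp (-(x * lam * (b - a)))) / (x * lam)) := by
  rw [intervalIntegral.integral_sub (by simp) (Continuous.intervalIntegrable (by fun_prop) _ _),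
    intervalIntegral.integral_finsetSum
      fun x _ => Continuous.intervalIntegrable (by fun_prop) _ _]
  simp only [intervalIntegral.integral_const, smul_eq_mul, mul_one]
  congr 1
  refine Finset.sum_congr rfl fun x hx => ?_
  have hx0 : (x : ℝ) ≠ 0 := by
    rw [Finset.mem_Icc] at hx
    exact_mod_cast (by omega : x ≠ 0)
  rw [intervalIntegral.integral_const_mul]
  congr 1
  have hfun : ∀ v : ℝ, Real.exp (-(lam * v)) ^ x = Real.exp (-(x * lam * v)) := fun v => by
    rw [← Real.exp_nat_mul]
    congr 1
    ring
  simp only [hfun]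
  rw [integral_exp_neg_mul _ _ _ (mul_ne_zero hx0 hlam), mul_sub, mul_one, ← Real.exp_add]
  congr 4
  ring

theorem stmt_11 (M N : ℕ) (hM : 1 ≤ M) (hMN : M ≤ N)
    (E : ℝ) (hE0 : 0 ≤ E) (hE1 : E ≤ 1)
    (n : ℕ) (hn : 1 ≤ n) (t : ℕ → ℝ) (ht0 : t 0 = 0)
    (hmono : ∀ i < n, t i < t (i + 1)) :
    Filter.Tendsto
      (fun lam : ℝ =>
        (1 - ∑ x ∈ Finset.Icc M N,
          S M N x *
            ∑ i ∈ Finset.Icc 1 n,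
              Real.exp (-((x : ℝ) * (1 - E) * lam * t (i - 1))) *
                (1 - Real.exp (-((x : ℝ) * lam * (t i - t (i - 1))))) /
                  ((x : ℝ) * lam * t n))
          / lam ^ (N - M + 1))
      (nhdsWithin 0 (Set.Ioi 0))
      (nhds ((N.choose (M - 1) : ℝ) / ((N : ℝ) - M + 2) * (1 / t n) *
        ∑ i ∈ Finset.Icc 1 n,
          ((t i - E * t (i - 1)) ^ (N - M + 2) - ((1 - E) * t (i - 1)) ^ (N - M + 2)))) := by
  have hnonneg : ∀ i ≤ n, 0 ≤ t i := by
    intro i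
    induction i with
    | zero => intro _; exact ht0.ge
    | succ i ih => intro hi; exact (ih (by omega)).trans (hmono i (by omega)).le
  have hn_pos : 0 < t n := by
    obtain ⟨m, rfl⟩ : ∃ m, n = m + 1 := ⟨n - 1, by omega⟩
    exact (hnonneg m (by omega)).trans_lt (hmono m (by omega))
  have htel : ∑ i ∈ Finset.Icc 1 n, (t i - t (i - 1)) = t n := by
    have hIcc : Finset.Icc 1 n = Finset.Ico (0 + 1) (n + 1) := by
      ext x; simp only [Finset.mem_Icc, Finset.mem_Ico]; omega
    rw [hIcc, ← Finset.sum_Ico_add', ← Finset.range_eq_Ico]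
    simp only [Nat.add_sub_cancel]
    rw [Finset.sum_range_sub, ht0, sub_zero]
  have hlim := (tendsto_finsetSum (Finset.Icc 1 n) fun i hi =>
    tendsto_integral_unavailability_div_pow M N hM hMN
      (a := (1 - E) * t (i - 1)) (b := t i - E * t (i - 1))
      (mul_nonneg (by linarith) (hnonneg _ (by rw [Finset.mem_Icc] at hi; omega)))
      (by
        rw [Finset.mem_Icc] at hi
        have h := hmono (i - 1) (by omega)
        rw [Nat.sub_add_cancel hi.1] at h
        linarith)).const_mul (1 / t n)
  rw [← Finset.mul_sum] at hlim
  rw [show ∀ c s : ℝ, c * (1 / t n) * s = 1 / t n * (c * s) by intros; ring]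
  refine hlim.congr' ?_
  filter_upwards [self_mem_nhdsWithin] with lam hlam
  have hlam0 : lam ≠ 0 := (Set.mem_Ioi.1 hlam).ne'
  simp only [intervalIntegral.integral_div, integral_unavailability M N hM hlam0]
  rw [← Finset.sum_div, mul_div_assoc']
  congr 1
  rw [Finset.sum_sub_distrib, Finset.sum_comm, mul_sub]
  congr 1
  · rw [Finset.sum_congr rfl fun i _ => show
      t i - E * t (i - 1) - (1 - E) * t (i - 1) = t i - t (i - 1) by ring, htel]
    field_simp
  · rw [Finset.mul_sum]
    refine Finset.sum_congr rfl fun x _ => ?_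
    rw [← Finset.mul_sum, mul_left_comm, Finset.mul_sum]
    congr 1
    refine Finset.sum_congr rfl fun i _ => ?_
    rw [show t i - E * t (i - 1) - (1 - E) * t (i - 1) = t i - t (i - 1) by ring,
      show (x : ℝ) * lam * ((1 - E) * t (i - 1)) = x * (1 - E) * lam * t (i - 1) by ring,
      one_div_mul_eq_div, div_div]
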